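/- Let 𝕋 be a time scale, c ∈ ℝ, m ∈ ℕ with m ≥ 1, and α ∈ ]0,1]. If f : 𝕋 → ℝ is defined by f(t) = (t − c)^m, then for every t ∈ 𝕋_κ, f is nabla fractional differentiable of order α at t with f^{∇^α}(t) = (t − ρ(t))^{1−α} · Σ_{ν=0}^{m−1} (ρ(t) − c)^ν (t − c)^{m−1−ν} if α ≠ 1, and f^{∇^α}(t) = Σ_{ν=0}^{m−1} (ρ(t) − c)^ν (t − c)^{m−1−ν} if α = 1. -/

import Mathlib

open Set Filter Topology
open scoped Classical

/-- Backward jump operator ρ on a time scale `T`: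
`ρ(t) = sup {s ∈ T | s < t}`, with `ρ(t) = t` when this set is empty. -/
noncomputable def TS.rho (T : Set ℝ) (t : ℝ) : ℝ :=
  if ({s | s ∈ T ∧ s < t}).Nonempty then sSup {s | s ∈ T ∧ s < t} else t

/-- Forward jump operator σ on a time scale `T`:
`σ(t) = inf {s ∈ T | s > t}`, with `σ(t) = t` when this set is empty. -/
noncomputable def TS.sigma (T : Set ℝ) (t : ℝ) : ℝ :=
  if ({s | s ∈ T ∧ t < s}).Nonempty then sInf {s | s ∈ T ∧ t < s} else t

/-- `𝕋_κ`: remove the minimum of `T` when it exists and is right-scattered. -/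
def TS.kappaLow (T : Set ℝ) : Set ℝ :=
  T \ {m | IsLeast T m ∧ m < TS.sigma T m}

/-- `𝕋^κ`: remove the maximum of `T` when it exists and is left-scattered. -/
def TS.kappaHigh (T : Set ℝ) : Set ℝ :=
  T \ {M | IsGreatest T M ∧ TS.rho T M < M}

/-- Signed real power: `x^α = sign(x) * |x|^α`.  For `x ≥ 0` this is the usual
real power; for `x < 0` it is `-(-x)^α` (in particular, for `α = 1/q` with `q`
odd, the real `q`-th root). -/
noncomputable def TS.fpow (x α : ℝ) : ℝ := Real.sign x * |x| ^ α

/-- `α` is of the form `1/q` for some odd natural number `q`. -/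
def TS.OddRecip (α : ℝ) : Prop := ∃ q : ℕ, Odd q ∧ α = 1 / (q : ℝ)

/-- `L` is the nabla fractional derivative of `f` of order `α` at `t` on the
time scale `T`.  If `α = 1/q` with `q` odd, a full `δ`-neighborhood of `t` in
`T` is used; otherwise only the right `δ`-neighborhood `[t, t+δ[ ∩ T`. -/
def TS.HasNablaFracDerivAt (T : Set ℝ) (f : ℝ → ℝ) (α t L : ℝ) : Prop :=
  (TS.OddRecip α → ∀ ε > (0:ℝ), ∃ δ > (0:ℝ), ∀ s ∈ T, |s - t| < δ →
      |(f s - f (TS.rho T t)) - L * TS.fpow (s - TS.rho T t) α|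
        ≤ ε * |s - TS.rho T t| ^ α) ∧
  (¬ TS.OddRecip α → ∀ ε > (0:ℝ), ∃ δ > (0:ℝ), ∀ s ∈ T, t ≤ s → s < t + δ →
      |(f s - f (TS.rho T t)) - L * TS.fpow (s - TS.rho T t) α|
        ≤ ε * |s - TS.rho T t| ^ α)

/-- `L` is a symmetric fractional derivative of `f` of order `α` at `t` on the
time scale `T`. -/
def TS.HasSymFracDerivAt (T : Set ℝ) (f : ℝ → ℝ) (α t L : ℝ) : Prop :=
  ∀ ε > (0:ℝ), ∃ δ > (0:ℝ), ∀ s ∈ T, |s - t| < δ →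
    2 * t - s ∈ T → |(2 * t - s) - t| < δ →
      |(f (TS.sigma T t) - f s + f (2 * t - s) - f (TS.rho T t))
          - L * TS.fpow (TS.sigma T t + 2 * t - 2 * s - TS.rho T t) α|
        ≤ ε * |TS.sigma T t + 2 * t - 2 * s - TS.rho T t| ^ α

theorem TS.rho_le_aux (T : Set ℝ) (t : ℝ) : TS.rho T t ≤ t := by
  unfold TS.rho
  split_ifs with h
  · exact csSup_le h (fun s hs => hs.2.le)
  · exact le_rfl

theorem TS.fpow_mul_aux (x α : ℝ) : TS.fpow x α * |x| ^ (1 - α) = x := by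
  unfold TS.fpow
  rcases eq_or_ne x 0 with rfl | hx
  · simp
  · have h : |x| ^ α * |x| ^ (1 - α) = |x| := by
      rw [← Real.rpow_add (abs_pos.mpr hx)]; simp
    rw [mul_assoc, h]
    rcases lt_or_gt_of_ne hx with h | h
    · rw [Real.sign_of_neg h, abs_of_neg h]; ring
    · rw [Real.sign_of_pos h, abs_of_pos h]; ring

theorem TS.abs_fpow_aux (x α : ℝ) : |TS.fpow x α| ≤ |x| ^ α := by
  unfold TS.fpow
  have h0 : 0 ≤ |x| ^ α := Real.rpow_nonneg (abs_nonneg x) α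
  rw [abs_mul, abs_of_nonneg h0]
  have h1 : |Real.sign x| ≤ 1 := by
    rcases Real.sign_apply_eq x with h | h | h <;> rw [h] <;> norm_num
  nlinarith

theorem TS.key_aux (c r t : ℝ) (hr : r ≤ t) (m : ℕ) (α : ℝ) (hα : α ≤ 1) (L : ℝ)
    (hL : L = if α = 1 then
          ∑ ν ∈ Finset.range m, (r - c) ^ ν * (t - c) ^ (m - 1 - ν)
        else
          TS.fpow (t - r) (1 - α) *
            ∑ ν ∈ Finset.range m, (r - c) ^ ν * (t - c) ^ (m - 1 - ν)) :
    ∀ ε > (0:ℝ), ∃ δ > (0:ℝ), ∀ s : ℝ, |s - t| < δ →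
      |((s - c) ^ m - (r - c) ^ m) - L * TS.fpow (s - r) α| ≤ ε * |s - r| ^ α := by
  set H : ℝ → ℝ := fun s => |s - r| ^ (1 - α) *
    ∑ ν ∈ Finset.range m, (r - c) ^ ν * (s - c) ^ (m - 1 - ν) with hH
  have hLH : L = H t := by
    rw [hL, hH]
    split_ifs with h
    · simp [h]
    · have h1 : 1 - α ≠ 0 := fun h' => h (by linarith)
      congr 1
      unfold TS.fpow
      rcases hr.eq_or_lt with h2 | h2
      · simp [h2, Real.zero_rpow h1]
      · rw [Real.sign_of_pos (by linarith), one_mul]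
  have hc : Continuous H := by
    refine Continuous.mul ?_ (by fun_prop)
    exact Continuous.rpow_const (by fun_prop) (fun x => Or.inr (by linarith))
  intro ε hε
  obtain ⟨δ, hδ, h⟩ := Metric.continuous_iff.mp hc t ε hε
  refine ⟨δ, hδ, fun s hs => ?_⟩
  have h1 := h s (by rwa [Real.dist_eq])
  rw [Real.dist_eq] at h1
  have h2 : (s - c) ^ m - (r - c) ^ m = TS.fpow (s - r) α * H s := by
    have h3 := (Commute.all (r - c) (s - c)).geom_sum₂_mul m
    have h4 := TS.fpow_mul_aux (s - r) α
    simp only [hH]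
    rw [← mul_assoc, h4]
    linear_combination h3
  rw [h2, hLH, show TS.fpow (s - r) α * H s - H t * TS.fpow (s - r) α
    = (H s - H t) * TS.fpow (s - r) α by ring, abs_mul]
  exact mul_le_mul h1.le (TS.abs_fpow_aux _ _) (abs_nonneg _) hε.le

/-- Nabla fractional derivative of `f(t) = (t - c)^m` for `m ≥ 1`. -/
theorem stmt16 (T : Set ℝ) (hTne : T.Nonempty) (hTcl : IsClosed T)
    (c : ℝ) (m : ℕ) (hm : 1 ≤ m) (α : ℝ) (hα : α ∈ Set.Ioc (0:ℝ) 1) :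
    ∀ t ∈ TS.kappaLow T,
      TS.HasNablaFracDerivAt T (fun s => (s - c) ^ m) α t
        (if α = 1 then
          ∑ ν ∈ Finset.range m, (TS.rho T t - c) ^ ν * (t - c) ^ (m - 1 - ν)
        else
          TS.fpow (t - TS.rho T t) (1 - α) *
            ∑ ν ∈ Finset.range m, (TS.rho T t - c) ^ ν * (t - c) ^ (m - 1 - ν)) := by
  intro t _
  have key := TS.key_aux c (TS.rho T t) t (TS.rho_le_aux T t) m α hα.2 _ rfl
  constructor
  · intro _ ε hε
    obtain ⟨δ, hδ, h⟩ := key ε hε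
    exact ⟨δ, hδ, fun s _ hs => h s hs⟩
  · intro _ ε hε
    obtain ⟨δ, hδ, h⟩ := key ε hε
    exact ⟨δ, hδ, fun s _ h1 h2 => h s (by rw [abs_of_nonneg] <;> linarith)⟩
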